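/- arXiv:2503.22076 — 9 statements merged into one kernel-verified Lean document; each statement's English description precedes it below -/
import Mathlib

section
/- For every integer n ≥ 1 and all j, k ∈ Fin n, the dot product cs_n(j)·cs_n(k) = cos θ_n(j)·cos θ_n(k) + sin θ_n(j)·sin θ_n(k) equals cos(2π((j:ℝ)−(k:ℝ))/n); it equals 1 when j = k, and it is at most 1 − 1/n² when j ≠ k. -/
open Real in
theorem cos_two_pi_mul_div_le_of_le_half {n d : ℝ} (hn : 0 < n) (hd : 1 ≤ d) (hdn : d ≤ n / 2) :
    cos (2 * π * d / n) ≤ 1 - 1 / n ^ 2 := by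
  have hpi := pi_pos
  have habs : |2 * π * d / n| ≤ π := by
    rw [abs_of_nonneg (by positivity), div_le_iff₀ hn]
    nlinarith
  have heq : 2 / π ^ 2 * (2 * π * d / n) ^ 2 = 8 * d ^ 2 / n ^ 2 := by
    field_simp
    ring
  have hle : 1 / n ^ 2 ≤ 8 * d ^ 2 / n ^ 2 := by
    gcongr
    nlinarith
  linarith [cos_le_one_sub_mul_cos_sq habs]

open Real in
theorem cos_two_pi_mul_div_le {n d : ℝ} (hn : 0 < n) (hd : 1 ≤ d) (hdn : d ≤ n - 1) :
    cos (2 * π * d / n) ≤ 1 - 1 / n ^ 2 := by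
  rcases le_total d (n / 2) with h | h
  · exact cos_two_pi_mul_div_le_of_le_half hn hd h
  · have heq : 2 * π * d / n = 2 * π - 2 * π * (n - d) / n := by
      field_simp
      ring
    rw [heq, cos_two_pi_sub]
    exact cos_two_pi_mul_div_le_of_le_half hn (by linarith) (by linarith)

/-- For every integer `n ≥ 1` and all `j, k ∈ Fin n`, the dot product
`cs_n(j)·cs_n(k) = cos θ_n(j)·cos θ_n(k) + sin θ_n(j)·sin θ_n(k)` equals
`cos (2π((j:ℝ) − (k:ℝ))/n)`; it equals `1` when `j = k`, and it is at most
`1 − 1/n²` when `j ≠ k`. -/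
theorem dot_product_cs_eq_cos (n : ℕ) (hn : 1 ≤ n) (j k : Fin n) :
    (Real.cos (2 * Real.pi * ((j : ℕ) : ℝ) / n) * Real.cos (2 * Real.pi * ((k : ℕ) : ℝ) / n)
      + Real.sin (2 * Real.pi * ((j : ℕ) : ℝ) / n) * Real.sin (2 * Real.pi * ((k : ℕ) : ℝ) / n)
      = Real.cos (2 * Real.pi * (((j : ℕ) : ℝ) - ((k : ℕ) : ℝ)) / n))
    ∧ (j = k → Real.cos (2 * Real.pi * (((j : ℕ) : ℝ) - ((k : ℕ) : ℝ)) / n) = 1)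
    ∧ (j ≠ k → Real.cos (2 * Real.pi * (((j : ℕ) : ℝ) - ((k : ℕ) : ℝ)) / n)
        ≤ 1 - 1 / (n : ℝ) ^ 2) := by
  have hn0 : (0 : ℝ) < n := by exact_mod_cast hn
  have bound_of_lt (a b : Fin n) (hab : a < b) :
      Real.cos (2 * Real.pi * (((b : ℕ) : ℝ) - ((a : ℕ) : ℝ)) / n) ≤ 1 - 1 / (n : ℝ) ^ 2 := by
    have h₁ : ((a : ℕ) : ℝ) + 1 ≤ ((b : ℕ) : ℝ) := by exact_mod_cast hab
    have h₂ : ((b : ℕ) : ℝ) + 1 ≤ (n : ℝ) := by exact_mod_cast b.isLt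
    have h₃ : (0 : ℝ) ≤ ((a : ℕ) : ℝ) := Nat.cast_nonneg _
    exact cos_two_pi_mul_div_le hn0 (by linarith) (by linarith)
  refine ⟨?_, ?_, ?_⟩
  · rw [← Real.cos_sub]
    congr 1
    ring
  · rintro rfl
    simp
  · intro hjk
    rcases lt_or_gt_of_ne hjk with h | h
    · rw [← Real.cos_neg]
      convert bound_of_lt j k h using 2
      ring
    · exact bound_of_lt k j h
end

section
/- Let n ≥ 1 be an integer, f : Fin n → Fin n any function, π a permutation of Fin n, and i* ∈ Fin n. Define scores s : Fin (n+1) → ℝ by s(j) = cos(2π((i*:ℝ) − (π j:ℝ))/n)/√2 for j coming from Fin n, and s(n) = 1/√2. Then: (a) the least element of Fin (n+1) at which s attains its maximum is the embedding of j₀ := π⁻¹(i*); and (b) the unique k ∈ Fin n maximizing k ↦ cos(2π((k:ℝ) − (f (π j₀):ℝ))/n) is f(i*). Consequently, the explicit 1-layer leftmost-hard-attention transformer of Theorem 1 (one head, embedding dimension 4, no position embedding) outputs f(i*) on every input presenting the pairs (π(j), f(π(j))) in the same position with permuted keys (case 3), and in particular also with ordered keys (case 2). -/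
/-- The attention scores at the final position in the case-3 construction of Theorem 1:
`s(j) = cos (2π((i*:ℝ) − (σ j:ℝ))/n)/√2` for `j` coming from `Fin n`, and `s(n) = 1/√2`. -/
noncomputable def case3Scores (n : ℕ) (σ : Equiv.Perm (Fin n)) (istar : Fin n) :
    Fin (n + 1) → ℝ :=
  Fin.lastCases (1 / Real.sqrt 2)
    (fun j => Real.cos (2 * Real.pi * (((istar : ℕ) : ℝ) - ((σ j : ℕ) : ℝ)) / n) / Real.sqrt 2)

/-- Distinct keys in `Fin n` have distinct angles on the circle. -/
theorem Fin.cos_two_pi_mul_sub_div_eq_one_iff {n : ℕ} (a b : Fin n) :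
    Real.cos (2 * Real.pi * (((a : ℕ) : ℝ) - ((b : ℕ) : ℝ)) / n) = 1 ↔ a = b := by
  refine ⟨fun h => ?_, fun h => by simp [h]⟩
  have hn : (n : ℝ) ≠ 0 := Nat.cast_ne_zero.mpr (Nat.ne_zero_of_lt a.isLt)
  obtain ⟨m, hm⟩ := (Real.cos_eq_one_iff _).mp h
  rw [eq_div_iff hn] at hm
  have hmul : (m : ℝ) * n = (a : ℕ) - (b : ℕ) :=
    mul_left_cancel₀ Real.two_pi_pos.ne' (by linear_combination hm)
  have hz : ((a : ℕ) : ℤ) - (b : ℕ) = m * n := by exact_mod_cast hmul.symm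
  have hdvd : (n : ℤ) ∣ ((a : ℕ) : ℤ) - (b : ℕ) := ⟨m, by rw [hz, mul_comm]⟩
  have := Int.eq_zero_of_abs_lt_dvd hdvd (by rw [abs_lt]; omega)
  exact Fin.ext (by omega)

theorem case3Scores_last (n : ℕ) (σ : Equiv.Perm (Fin n)) (istar : Fin n) :
    case3Scores n σ istar (Fin.last n) = 1 / Real.sqrt 2 := by
  simp [case3Scores]

theorem case3Scores_castSucc (n : ℕ) (σ : Equiv.Perm (Fin n)) (istar j : Fin n) :
    case3Scores n σ istar j.castSucc =
      Real.cos (2 * Real.pi * (((istar : ℕ) : ℝ) - ((σ j : ℕ) : ℝ)) / n) / Real.sqrt 2 := by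
  simp [case3Scores]

theorem case3Scores_le (n : ℕ) (σ : Equiv.Perm (Fin n)) (istar : Fin n) (j : Fin (n + 1)) :
    case3Scores n σ istar j ≤ 1 / Real.sqrt 2 := by
  cases j using Fin.lastCases with
  | last => rw [case3Scores_last]
  | cast j =>
    rw [case3Scores_castSucc]
    gcongr
    exact Real.cos_le_one _

theorem case3Scores_castSucc_eq_iff (n : ℕ) (σ : Equiv.Perm (Fin n)) (istar j : Fin n) :
    case3Scores n σ istar j.castSucc = 1 / Real.sqrt 2 ↔ j = σ.symm istar := by
  rw [case3Scores_castSucc, div_left_inj' (by positivity),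
    Fin.cos_two_pi_mul_sub_div_eq_one_iff, Equiv.eq_symm_apply, eq_comm]

/-- Let `n ≥ 1`, `f : Fin n → Fin n` any function, `σ` a permutation of
`Fin n`, and `i* ∈ Fin n`.  Then (a) the least element of `Fin (n+1)` at which the
scores `case3Scores n σ i*` attain their maximum is the embedding of `j₀ := σ⁻¹ i*`;
and (b) the unique `k ∈ Fin n` maximizing `k ↦ cos (2π((k:ℝ) − (f (σ j₀):ℝ))/n)` is
`f i*`.  Hence the 1-layer leftmost-hard-attention transformer of Theorem 1 outputs
`f(i*)` on every case-3 (and case-2) input. -/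
theorem case3_one_layer_transformer_correct (n : ℕ) (hn : 1 ≤ n)
    (f : Fin n → Fin n) (σ : Equiv.Perm (Fin n)) (istar : Fin n) :
    IsLeast {j : Fin (n + 1) | ∀ j' : Fin (n + 1),
        case3Scores n σ istar j' ≤ case3Scores n σ istar j}
      ((σ.symm istar).castSucc)
    ∧ ((∀ k : Fin n,
          Real.cos (2 * Real.pi * (((k : ℕ) : ℝ) - ((f (σ (σ.symm istar)) : ℕ) : ℝ)) / n)
            ≤ Real.cos (2 * Real.pi *
                (((f istar : ℕ) : ℝ) - ((f (σ (σ.symm istar)) : ℕ) : ℝ)) / n))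
        ∧ (∀ k : Fin n,
            (∀ k' : Fin n,
              Real.cos (2 * Real.pi * (((k' : ℕ) : ℝ) - ((f (σ (σ.symm istar)) : ℕ) : ℝ)) / n)
                ≤ Real.cos (2 * Real.pi *
                    (((k : ℕ) : ℝ) - ((f (σ (σ.symm istar)) : ℕ) : ℝ)) / n)) →
            k = f istar)) := by
  refine ⟨⟨fun j => ?_, fun j hj => ?_⟩, ?_, fun k hk => ?_⟩
  · rw [(case3Scores_castSucc_eq_iff n σ istar _).mpr rfl]
    exact case3Scores_le n σ istar j
  · cases j using Fin.lastCases with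
    | last => exact Fin.le_last _
    | cast j =>
      have hmax := hj (Fin.last n)
      rw [case3Scores_last] at hmax
      rw [(case3Scores_castSucc_eq_iff n σ istar j).mp
        (le_antisymm (case3Scores_le n σ istar _) hmax)]
  · intro k
    rw [Equiv.apply_symm_apply, (Fin.cos_two_pi_mul_sub_div_eq_one_iff _ _).mpr rfl]
    exact Real.cos_le_one _
  · rw [Equiv.apply_symm_apply] at hk
    have hmax := hk (f istar)
    rw [(Fin.cos_two_pi_mul_sub_div_eq_one_iff _ _).mpr rfl] at hmax
    exact (Fin.cos_two_pi_mul_sub_div_eq_one_iff k (f istar)).mp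
      (le_antisymm (Real.cos_le_one _) hmax)
end

section
/- Let n ≥ 1 be an integer, M any type, A : (Fin n → Fin n) → M, and B : M → Equiv.Perm (Fin n) → Fin n. If the protocol (A, B) is correct, i.e., B (A v) π = v (π⁻¹ 0) for every v : Fin n → Fin n and every permutation π of Fin n, then A is injective; in particular, if M is a finite type then the cardinality of M is at least n^n, so Alice's message must in some case consist of at least n·log₂ n bits. -/
/-- Let `n ≥ 1`, `M` any type, `A : (Fin n → Fin n) → M` (Alice's message)
and `B : M → Equiv.Perm (Fin n) → Fin n` (Bob's output).  If the protocol is correct,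
i.e. `B (A v) π = v (π⁻¹ 0)` for every value sequence `v` and permutation `π`, then `A`
is injective; in particular, if `M` is a finite type then `card M ≥ n ^ n`, so Alice's
message must in some case consist of at least `n · log₂ n` bits. -/
theorem alice_message_injective_and_card_lower_bound (n : ℕ) (hn : 1 ≤ n)
    (M : Type*) (A : (Fin n → Fin n) → M) (B : M → Equiv.Perm (Fin n) → Fin n)
    (hcorrect : ∀ (v : Fin n → Fin n) (π : Equiv.Perm (Fin n)), B (A v) π = v (π⁻¹ ⟨0, hn⟩)) :
    Function.Injective A ∧ ∀ (_ : Fintype M), n ^ n ≤ Fintype.card M := by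
  have hinj : Function.Injective A := by
    intro v w h
    funext i
    have hv := hcorrect v (Equiv.swap i ⟨0, hn⟩)
    have hw := hcorrect w (Equiv.swap i ⟨0, hn⟩)
    rw [Equiv.swap_inv, Equiv.swap_apply_right] at hv hw
    rw [← hv, ← hw, h]
  refine ⟨hinj, fun _ => ?_⟩
  simpa using Fintype.card_le_of_injective A hinj
end

section
/- There exists a constant C ∈ ℕ such that for every integer n ≥ C the following holds. Let M be a finite type, R a real number, A : (Fin n → Fin n) → M, and B : M → Equiv.Perm (Fin n) → Fin n, and suppose (card M : ℝ) ≤ 2^(n·log₂ n − R) (i.e., Alice sends at most n·log₂ n − R bits). Then the number of pairs (v, π) ∈ (Fin n → Fin n) × Equiv.Perm (Fin n) with B (A v) π ≠ v (π⁻¹ 0) is at least (R/(3·n·log₂ n)) · n^n · n!; equivalently, if the value sequence v and the permutation π are chosen independently and uniformly at random, the probability that Bob's output is incorrect is at least R/(3·n·log₂ n). -/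
open Finset in
/-- The generating function of the Hamming distance to a fixed word. -/
theorem sum_pow_hammingDist {ι α : Type*} [Fintype ι] [DecidableEq ι] [Fintype α] [DecidableEq α]
    (w : ι → α) (t : ℝ) :
    ∑ v : ι → α, t ^ hammingDist v w
      = (1 + ((Fintype.card α : ℝ) - 1) * t) ^ Fintype.card ι := by
  have hprod : ∀ v : ι → α, t ^ hammingDist v w = ∏ i, if v i = w i then 1 else t := by
    intro v
    rw [prod_ite]
    simp [hammingDist]
  have hsum : ∀ i, ∑ a : α, (if a = w i then 1 else t)
      = 1 + ((Fintype.card α : ℝ) - 1) * t := by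
    intro i
    have hcard : 1 ≤ Fintype.card α := Fintype.card_pos_iff.mpr ⟨w i⟩
    rw [← add_sum_erase univ _ (mem_univ (w i)), if_pos rfl,
      sum_congr rfl fun a ha => if_neg (ne_of_mem_erase ha), sum_const,
      card_erase_of_mem (mem_univ _), card_univ, nsmul_eq_mul, Nat.cast_sub hcard, Nat.cast_one]
  simp_rw [hprod]
  rw [← Fintype.piFinset_univ, ← prod_univ_sum (fun _ => univ) (fun i a => if a = w i then 1 else t)]
  simp [hsum]

/-- If words are encoded into `M` and decoded by `g`, the generating function of the decoding
error counts is at most `card M` times that of the distance to a single word. -/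
theorem sum_pow_hammingDist_decode_le {ι α M : Type*} [Fintype ι] [DecidableEq ι] [Fintype α]
    [DecidableEq α] [Fintype M] (A : (ι → α) → M) (g : M → ι → α) {t : ℝ} (ht : 0 ≤ t) :
    ∑ v : ι → α, t ^ hammingDist v (g (A v))
      ≤ Fintype.card M * (1 + ((Fintype.card α : ℝ) - 1) * t) ^ Fintype.card ι := by
  calc ∑ v : ι → α, t ^ hammingDist v (g (A v))
      ≤ ∑ v : ι → α, ∑ m : M, t ^ hammingDist v (g m) :=
        Finset.sum_le_sum fun v _ =>
          Finset.single_le_sum (f := fun m => t ^ hammingDist v (g m))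
            (fun m _ => pow_nonneg ht _) (Finset.mem_univ (A v))
    _ = _ := by
        rw [Finset.sum_comm]
        simp_rw [sum_pow_hammingDist]
        simp

/-- Exponential (tangent line) form of Jensen's inequality: a small sum of `d` forces a large sum
of `exp (-c * d)`. -/
theorem card_mul_exp_le_sum_exp {β : Type*} [Fintype β] (d : β → ℝ) {c D : ℝ} (hc : 0 ≤ c)
    (h : ∑ b, d b ≤ D * Fintype.card β) :
    Fintype.card β * Real.exp (-(c * D)) ≤ ∑ b, Real.exp (-(c * d b)) := by
  have hterm : ∀ b, Real.exp (-(c * D)) * (1 - c * (d b - D)) ≤ Real.exp (-(c * d b)) := by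
    intro b
    have he : Real.exp (-(c * d b)) = Real.exp (-(c * D)) * Real.exp (-(c * (d b - D))) := by
      rw [← Real.exp_add]
      ring_nf
    rw [he]
    gcongr
    linarith [Real.add_one_le_exp (-(c * (d b - D)))]
  refine le_trans ?_ (Finset.sum_le_sum fun b _ => hterm b)
  rw [← Finset.mul_sum, mul_comm]
  gcongr
  simp only [mul_sub, Finset.sum_sub_distrib, ← Finset.mul_sum, Finset.sum_const, Finset.card_univ,
    nsmul_eq_mul]
  nlinarith [mul_le_mul_of_nonneg_left h hc]

/-- If `n ^ n` words are encoded with at most `n log₂ n - R` bits, the average number of wrongly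
decoded letters is at least `R / (3 log₂ n)`. -/
theorem le_sum_hammingDist_decode {n : ℕ} (hn : 16 < n) {M : Type*} [Fintype M] {R : ℝ}
    (A : (Fin n → Fin n) → M) (g : M → Fin n → Fin n)
    (hM : (Fintype.card M : ℝ) ≤ (2 : ℝ) ^ ((n : ℝ) * Real.logb 2 n - R)) :
    R / (3 * Real.logb 2 n) * (n : ℝ) ^ n
      ≤ ∑ v : Fin n → Fin n, (hammingDist v (g (A v)) : ℝ) := by
  have hnR : (16 : ℝ) < n := by exact_mod_cast hn
  have hn0 : (0 : ℝ) < n := by linarith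
  have hlog2 : (0.69 : ℝ) < Real.log 2 := by linarith [Real.log_two_gt_d9]
  have hlogn : 4 * Real.log 2 ≤ Real.log n := by
    have h := Real.log_le_log (by norm_num) hnR.le
    rw [show (16 : ℝ) = 2 ^ 4 by norm_num, Real.log_pow] at h
    exact_mod_cast h
  have hlogb : 4 ≤ Real.logb 2 n := by
    rw [Real.logb, le_div_iff₀ (by linarith)]
    exact hlogn
  have hM' : (Fintype.card M : ℝ) ≤ (n : ℝ) ^ n * Real.exp (-(R * Real.log 2)) := by
    refine hM.trans_eq ?_
    rw [Real.rpow_sub two_pos, mul_comm (n : ℝ), Real.rpow_mul two_pos.le,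
      Real.rpow_logb two_pos (by norm_num) hn0, Real.rpow_natCast, Real.exp_neg,
      Real.rpow_def_of_pos two_pos, mul_comm R, div_eq_mul_inv]
  have hpow : (0 : ℝ) < (n : ℝ) ^ n := by positivity
  rcases le_or_gt R 0 with hR | hR
  · refine le_trans ?_ (Finset.sum_nonneg fun v _ => Nat.cast_nonneg _)
    have : R / (3 * Real.logb 2 n) ≤ 0 := div_nonpos_of_nonpos_of_nonneg hR (by linarith)
    exact mul_nonpos_of_nonpos_of_nonneg this hpow.le
  rcases le_or_gt R 5 with hR5 | hR5
  · have hzero := sum_pow_hammingDist_decode_le A g (le_refl (0 : ℝ))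
    have hterm : ∀ v : Fin n → Fin n,
        1 - (hammingDist v (g (A v)) : ℝ) ≤ 0 ^ hammingDist v (g (A v)) := by
      intro v
      rcases Nat.eq_zero_or_pos (hammingDist v (g (A v))) with h | h
      · simp [h]
      · rw [zero_pow h.ne']
        have : (1 : ℝ) ≤ hammingDist v (g (A v)) := by exact_mod_cast h
        linarith
    have hsum := (Finset.sum_le_sum fun v (_ : v ∈ Finset.univ) => hterm v).trans hzero
    simp only [Finset.sum_sub_distrib, Finset.sum_const, Finset.card_univ, nsmul_eq_mul,
      Fintype.card_fun, Fintype.card_fin, mul_zero, add_zero, one_pow, mul_one,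
      Nat.cast_pow] at hsum
    have hexp : Real.exp (-(R * Real.log 2)) ≤ 1 - R / 12 := by
      have h1 : 1 + R * 0.69 ≤ Real.exp (R * Real.log 2) := by
        nlinarith [Real.add_one_le_exp (R * Real.log 2)]
      rw [Real.exp_neg]
      refine inv_le_of_inv_le₀ (by linarith) ((inv_le_of_inv_le₀ (by linarith) ?_).trans h1)
      rw [inv_le_iff_one_le_mul₀ (by linarith)]
      nlinarith
    have hdiv : R / (3 * Real.logb 2 n) ≤ R / 12 :=
      div_le_div_of_nonneg_left hR.le (by norm_num) (by linarith)
    nlinarith [mul_le_mul_of_nonneg_left hexp hpow.le, mul_le_mul_of_nonneg_right hdiv hpow.le]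
  · by_contra! hlt
    have hcard : (Fintype.card (Fin n → Fin n) : ℝ) = (n : ℝ) ^ n := by simp
    have hJ := card_mul_exp_le_sum_exp (fun v => (hammingDist v (g (A v)) : ℝ))
      (c := 2 * Real.log n) (D := R / (3 * Real.logb 2 n)) (by linarith) (by
        rw [hcard]
        exact hlt.le)
    have ht : ∀ k : ℕ, Real.exp (-(2 * Real.log n * k)) = (((n : ℝ) ^ 2)⁻¹) ^ k := by
      intro k
      rw [show -(2 * Real.log n * k) = k * (-(2 * Real.log n)) by ring, Real.exp_nat_mul,
        Real.exp_neg, mul_comm 2, Real.exp_mul, Real.exp_log hn0, Real.rpow_two]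
    simp_rw [ht] at hJ
    have hJ' := hJ.trans (sum_pow_hammingDist_decode_le A g (by positivity))
    have hbase : (1 + ((n : ℝ) - 1) * ((n : ℝ) ^ 2)⁻¹) ^ n ≤ Real.exp 1 := by
      have h1 : 1 + ((n : ℝ) - 1) * ((n : ℝ) ^ 2)⁻¹ ≤ Real.exp (1 / n) := by
        refine le_trans ?_ (Real.add_one_le_exp _)
        have : ((n : ℝ) - 1) * ((n : ℝ) ^ 2)⁻¹ ≤ n * ((n : ℝ) ^ 2)⁻¹ := by gcongr; linarith
        have h2 : (n : ℝ) * ((n : ℝ) ^ 2)⁻¹ = 1 / n := by field_simp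
        linarith
      have h0 : 0 ≤ 1 + ((n : ℝ) - 1) * ((n : ℝ) ^ 2)⁻¹ :=
        add_nonneg zero_le_one (mul_nonneg (by linarith) (by positivity))
      refine (pow_le_pow_left₀ h0 h1 n).trans_eq ?_
      rw [← Real.exp_nat_mul, mul_one_div_cancel hn0.ne']
    have hlam : 2 * Real.log n * (R / (3 * Real.logb 2 n)) = 2 / 3 * (R * Real.log 2) := by
      have : Real.log n ≠ 0 := by linarith
      have : Real.log 2 ≠ 0 := by linarith
      rw [Real.logb]
      field_simp
    rw [hcard, hlam, Fintype.card_fin] at hJ'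
    have hfinal := hJ'.trans (mul_le_mul hM' hbase (pow_nonneg (add_nonneg zero_le_one
      (mul_nonneg (by linarith) (by positivity))) n) (by positivity))
    rw [mul_assoc, ← Real.exp_add, mul_le_mul_iff_right₀ hpow, Real.exp_le_exp] at hfinal
    nlinarith

/-- The number of errors of a two-party protocol, counted `n` times, is the total over all `σ` of
the decoding errors when the permutations `σ * (· + i)` are used to read off all positions. -/
theorem sum_hammingDist_eq_mul_card_errors {n : ℕ} [NeZero n] {M : Type*}
    (A : (Fin n → Fin n) → M) (B : M → Equiv.Perm (Fin n) → Fin n) (z : Fin n) :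
    ∑ σ : Equiv.Perm (Fin n), ∑ v : Fin n → Fin n,
        hammingDist v (fun j => B (A v) (σ * Equiv.addRight (σ⁻¹ z - j)))
      = n * (Finset.univ.filter (fun p : (Fin n → Fin n) × Equiv.Perm (Fin n) =>
          B (A p.1) p.2 ≠ p.1 (p.2⁻¹ z))).card := by
  have hshift : ∀ (σ : Equiv.Perm (Fin n)) (v : Fin n → Fin n),
      hammingDist v (fun j => B (A v) (σ * Equiv.addRight (σ⁻¹ z - j)))
        = ∑ i : Fin n, if B (A v) (σ * Equiv.addRight i) ≠ v ((σ * Equiv.addRight i)⁻¹ z)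
            then 1 else 0 := by
    intro σ v
    rw [hammingDist, Finset.card_filter]
    refine Eq.trans (Finset.sum_congr rfl fun j _ => ?_) ((Equiv.subLeft (σ⁻¹ z)).sum_comp _)
    have : (σ * Equiv.addRight (σ⁻¹ z - j))⁻¹ z = j := by
      rw [Equiv.Perm.inv_eq_iff_eq]
      simp
    simp only [Equiv.subLeft_apply, this, ne_comm]
  simp_rw [hshift]
  calc _ = ∑ i : Fin n, ∑ v : Fin n → Fin n, ∑ σ : Equiv.Perm (Fin n),
        (if B (A v) (σ * Equiv.addRight i) ≠ v ((σ * Equiv.addRight i)⁻¹ z) then 1 else 0) := by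
        rw [Finset.sum_comm, Finset.sum_comm (s := (Finset.univ : Finset (Fin n)))]
        exact Finset.sum_congr rfl fun v _ => Finset.sum_comm
    _ = ∑ _i : Fin n, ∑ v : Fin n → Fin n, ∑ σ : Equiv.Perm (Fin n),
        (if B (A v) σ ≠ v (σ⁻¹ z) then 1 else 0) := by
        refine Finset.sum_congr rfl fun i _ => Finset.sum_congr rfl fun v _ => ?_
        exact Equiv.sum_comp (Equiv.mulRight (Equiv.addRight i))
          fun σ : Equiv.Perm (Fin n) => if B (A v) σ ≠ v (σ⁻¹ z) then 1 else 0
    _ = _ := by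
        rw [Finset.card_filter, Fintype.sum_prod_type]
        simp

/-- There is a constant `C` such that for every `n ≥ C` the following holds.
For every finite message type `M`, real `R`, and protocol `A : (Fin n → Fin n) → M`,
`B : M → Equiv.Perm (Fin n) → Fin n` with `card M ≤ 2 ^ (n·log₂ n − R)` (Alice sends at
most `n·log₂ n − R` bits), the number of pairs `(v, π)` on which Bob's output is
incorrect, i.e. `B (A v) π ≠ v (π⁻¹ 0)`, is at least `(R/(3·n·log₂ n)) · n^n · n!`;
equivalently, for `v` and `π` independent and uniform, the probability of an incorrect
output is at least `R/(3·n·log₂ n)`. -/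
theorem probabilistic_error_lower_bound :
    ∃ C : ℕ, ∀ n : ℕ, ∀ _hn : C < n,
      ∀ (M : Type) (_ : Fintype M) (R : ℝ)
        (A : (Fin n → Fin n) → M) (B : M → Equiv.Perm (Fin n) → Fin n),
        (Fintype.card M : ℝ) ≤ (2 : ℝ) ^ ((n : ℝ) * Real.logb 2 n - R) →
        (R / (3 * n * Real.logb 2 n)) * (n : ℝ) ^ n * (Nat.factorial n : ℝ) ≤
          ((Finset.univ.filter
              (fun p : (Fin n → Fin n) × Equiv.Perm (Fin n) =>
                B (A p.1) p.2 ≠ p.1 (p.2⁻¹ ⟨0, by omega⟩))).card : ℝ) := by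
  refine ⟨16, fun n hn M _ R A B hM => ?_⟩
  have : NeZero n := ⟨by omega⟩
  have hn0 : (0 : ℝ) < n := by exact_mod_cast (by omega : 0 < n)
  have hcount := sum_hammingDist_eq_mul_card_errors A B ⟨0, by omega⟩
  have hσ := Finset.sum_le_sum fun (σ : Equiv.Perm (Fin n)) (_ : σ ∈ Finset.univ) =>
    le_sum_hammingDist_decode hn A
      (fun m j => B m (σ * Equiv.addRight (σ⁻¹ ⟨0, by omega⟩ - j))) hM
  have hcountR := congrArg (Nat.cast : ℕ → ℝ) hcount
  push_cast at hcountR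
  rw [hcountR, Finset.sum_const, Finset.card_univ, Fintype.card_perm, Fintype.card_fin,
    nsmul_eq_mul] at hσ
  refine le_of_mul_le_mul_left (le_trans (le_of_eq ?_) hσ) hn0
  rw [mul_right_comm 3, ← div_div]
  field_simp
end

section
/- Let n ≥ 1 be an integer. Consider sequences x : Fin (2n+1) → Fin n such that the map Fin n → Fin n given by j ↦ x(2j) is a bijection (the even-indexed entries among the first 2n positions form a permutation of Fin n). The map sending such a sequence x to its normalized value vector, namely the function Fin (2n+1) → ℝ given by j ↦ ((x j : ℝ) + 1) / (∑_{k ∈ Fin (2n+1)} ((x k : ℝ) + 1)), is injective on the set of such sequences: if two sequences whose even parts are bijections have equal normalized value vectors, then the sequences are equal. -/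
/-- The even position `2k` in a sequence of length `2n+1`. -/
def evenPos {n : ℕ} (k : Fin n) : Fin (2 * n + 1) :=
  ⟨2 * (k : ℕ), by have := k.isLt; omega⟩

/-- Along the even positions, the unnormalized values add up to the sum of `k + 1` over all
`k : Fin n`, independently of the order of the keys. -/
theorem sum_evenPos_eq {n : ℕ} (x : Fin (2 * n + 1) → Fin n)
    (hx : Function.Bijective (fun j : Fin n => x (evenPos j))) :
    ∑ j : Fin n, (((x (evenPos j) : ℕ) : ℝ) + 1) = ∑ k : Fin n, (((k : ℕ) : ℝ) + 1) :=
  hx.sum_comp (fun k : Fin n => ((k : ℕ) : ℝ) + 1)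

/-- The normalizing constant is positive. -/
theorem sum_value_add_one_pos {n : ℕ} (x : Fin (2 * n + 1) → Fin n) :
    0 < ∑ k : Fin (2 * n + 1), (((x k : ℕ) : ℝ) + 1) :=
  Finset.sum_pos (fun _ _ => by positivity) Finset.univ_nonempty

/-- Let `n ≥ 1`.  On sequences `x : Fin (2n+1) → Fin n` whose even-indexed
entries among the first `2n` positions form a permutation of `Fin n` (i.e.
`j ↦ x (2j)` is a bijection), the map sending `x` to its normalized value vector
`j ↦ ((x j : ℝ) + 1) / ∑ k, ((x k : ℝ) + 1)` is injective: if two such sequences have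
equal normalized value vectors, then they are equal. -/
theorem normalized_value_vector_injective (n : ℕ) (hn : 1 ≤ n)
    (x y : Fin (2 * n + 1) → Fin n)
    (hx : Function.Bijective (fun j : Fin n => x (evenPos j)))
    (hy : Function.Bijective (fun j : Fin n => y (evenPos j)))
    (h : (fun j : Fin (2 * n + 1) =>
            (((x j : ℕ) : ℝ) + 1) / ∑ k : Fin (2 * n + 1), (((x k : ℕ) : ℝ) + 1))
        = (fun j : Fin (2 * n + 1) =>
            (((y j : ℕ) : ℝ) + 1) / ∑ k : Fin (2 * n + 1), (((y k : ℕ) : ℝ) + 1))) :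
    x = y := by
  have hsum := Finset.sum_congr (rfl : (Finset.univ : Finset (Fin n)) = Finset.univ)
    fun j _ => congrFun h (evenPos j)
  have hSx := sum_value_add_one_pos x
  have hSy := sum_value_add_one_pos y
  have hT : 0 < ∑ k : Fin n, (((k : ℕ) : ℝ) + 1) :=
    Finset.sum_pos (fun _ _ => by positivity) ⟨⟨0, hn⟩, Finset.mem_univ _⟩
  simp only [← Finset.sum_div, sum_evenPos_eq x hx, sum_evenPos_eq y hy] at hsum
  have hS : ∑ k, (((x k : ℕ) : ℝ) + 1) = ∑ k, (((y k : ℕ) : ℝ) + 1) := by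
    rw [div_eq_div_iff hSx.ne' hSy.ne'] at hsum
    exact (mul_left_cancel₀ hT.ne' hsum).symm
  funext j
  have hj := congrFun h j
  simp only [hS, div_left_inj' hSy.ne', add_left_inj, Nat.cast_inj] at hj
  exact Fin.ext hj
end

section
/- Let n ≥ 4 be an integer. There do not exist functions s : Fin (2n+1) → Fin n → ℝ (attention scores) and o : Fin (2n+1) → Fin n → Fin n (output rule) with the following property: for every permutation π of Fin n and every f : Fin n → Fin n, letting t : Fin (2n+1) → Fin n be the case-5 input with target key 0, and letting j* be the least j ∈ Fin (2n+1) maximizing j ↦ s j (t j), one has o j* (t j*) = f(0). -/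
/-- The case-5 input sequence of length `2n+1` determined by a key permutation `σ`, a
function `f`, and a target key `istar`: position `2j` holds `σ j`, position `2j+1`
holds `f (σ j)`, and position `2n` holds `istar`. -/
def caseFiveInput {n : ℕ} (σ : Equiv.Perm (Fin n)) (f : Fin n → Fin n) (istar : Fin n) :
    Fin (2 * n + 1) → Fin n :=
  fun j =>
    if h : (j : ℕ) < 2 * n then
      if (j : ℕ) % 2 = 0 then σ ⟨(j : ℕ) / 2, by omega⟩ else f (σ ⟨(j : ℕ) / 2, by omega⟩)
    else istar

/-- A real-valued function on a nonempty finite linear order has a least maximizer. -/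
theorem exists_isLeast_argmax {ι : Type*} [LinearOrder ι] [Finite ι] [Nonempty ι] (g : ι → ℝ) :
    ∃ i, IsLeast {j | ∀ k, g k ≤ g j} i := by
  obtain ⟨m, hm⟩ := Finite.exists_max g
  obtain ⟨i, hi, hmin⟩ := wellFounded_lt.has_min {j | ∀ k, g k ≤ g j} ⟨m, hm⟩
  exact ⟨i, hi, fun j hj => not_lt.mp (hmin j hj)⟩

/-- If `g` and `h` agree away from `p` and neither has `p` as its least maximizer, then the least
maximizer of `g` is at most that of `h`. -/
theorem isLeast_argmax_le_of_eqOn {ι : Type*} [LinearOrder ι] {g h : ι → ℝ} {p i j : ι}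
    (hgh : ∀ k, k ≠ p → g k = h k) (hi : IsLeast {j | ∀ k, g k ≤ g j} i)
    (hj : IsLeast {j | ∀ k, h k ≤ h j} j) (hip : i ≠ p) (hjp : j ≠ p) : i ≤ j := by
  refine hi.2 fun k => ?_
  calc g k ≤ g i := hi.1 k
    _ = h i := hgh i hip
    _ ≤ h j := hj.1 i
    _ = g j := (hgh j hjp).symm

theorem caseFiveInput_odd {n : ℕ} (σ : Equiv.Perm (Fin n)) (f : Fin n → Fin n) (c a : Fin n) :
    caseFiveInput σ f c ⟨2 * a + 1, by omega⟩ = f (σ a) := by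
  have h₁ : 2 * (a : ℕ) + 1 < 2 * n := by omega
  have h₂ : (2 * (a : ℕ) + 1) % 2 ≠ 0 := by omega
  have h₃ : (2 * (a : ℕ) + 1) / 2 = a := by omega
  simp only [caseFiveInput, dif_pos h₁, if_neg h₂, h₃]

/-- Changing the value of `f` at `σ a` only affects position `2a+1` of the input. -/
theorem caseFiveInput_update_of_ne {n : ℕ} (σ : Equiv.Perm (Fin n)) (f : Fin n → Fin n)
    (c a y : Fin n) {j : Fin (2 * n + 1)} (hj : j ≠ ⟨2 * a + 1, by omega⟩) :
    caseFiveInput σ (Function.update f (σ a) y) c j = caseFiveInput σ f c j := by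
  unfold caseFiveInput
  split_ifs with h₁ h₂
  · rfl
  · refine Function.update_of_ne (fun he => hj ?_) _ _
    have := congrArg Fin.val (σ.injective he)
    ext
    simp only at this ⊢
    omega
  · rfl

/-- If leftmost hard attention computes `f c` on case-5 inputs and `σ a = c`, then some choice of
the value at `c` makes it attend to the position `2a+1` holding that value. -/
theorem exists_isLeast_argmax_odd {n : ℕ} (hn : 2 ≤ n) {s : Fin (2 * n + 1) → Fin n → ℝ}
    {o : Fin (2 * n + 1) → Fin n → Fin n} {c : Fin n}
    (H : ∀ (σ : Equiv.Perm (Fin n)) (f : Fin n → Fin n) (j : Fin (2 * n + 1)),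
      IsLeast {j | ∀ k, s k (caseFiveInput σ f c k) ≤ s j (caseFiveInput σ f c j)} j →
        o j (caseFiveInput σ f c j) = f c)
    (σ : Equiv.Perm (Fin n)) (f : Fin n → Fin n) {a : Fin n} (ha : σ a = c) :
    ∃ y, IsLeast {j | ∀ k, s k (caseFiveInput σ (Function.update f c y) c k) ≤
      s j (caseFiveInput σ (Function.update f c y) c j)} ⟨2 * a + 1, by omega⟩ := by
  subst ha
  by_contra! hne
  choose w hw using fun y => exists_isLeast_argmax
    fun k => s k (caseFiveInput σ (Function.update f (σ a) y) (σ a) k)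
  have hwp (y) : w y ≠ ⟨2 * a + 1, by omega⟩ := fun h => hne y (h ▸ hw y)
  have hle (y z) : w y ≤ w z := by
    refine isLeast_argmax_le_of_eqOn (fun k hk => ?_) (hw y) (hw z) (hwp y) (hwp z)
    rw [caseFiveInput_update_of_ne σ f _ a y hk, caseFiveInput_update_of_ne σ f _ a z hk]
  have ho (y) : o (w y) (caseFiveInput σ f (σ a) (w y)) = y := by
    have := H σ _ (w y) (hw y)
    rwa [caseFiveInput_update_of_ne σ f _ a y (hwp y), Function.update_self] at this
  have h₀₁ : (⟨0, by omega⟩ : Fin n) = ⟨1, by omega⟩ := by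
    rw [← ho ⟨0, by omega⟩, (hle ⟨0, by omega⟩ ⟨1, by omega⟩).antisymm (hle _ _), ho]
  simp at h₀₁

/-- leftmost hard attention part of Theorem 6: Let `n ≥ 4`.  There are no
attention scores `s : Fin (2n+1) → Fin n → ℝ` and output rule
`o : Fin (2n+1) → Fin n → Fin n` such that for every permutation `σ` of `Fin n` and every
`f : Fin n → Fin n`, with `t` the case-5 input with target key `0`, the least
`j* ∈ Fin (2n+1)` maximizing `j ↦ s j (t j)` satisfies `o j* (t j*) = f 0`. -/
theorem no_one_layer_leftmost_hard_attention_for_case5 (n : ℕ) (hn : 4 ≤ n) :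
    ¬ ∃ (s : Fin (2 * n + 1) → Fin n → ℝ) (o : Fin (2 * n + 1) → Fin n → Fin n),
      ∀ (σ : Equiv.Perm (Fin n)) (f : Fin n → Fin n),
        ∀ jstar : Fin (2 * n + 1),
          IsLeast {j : Fin (2 * n + 1) | ∀ j' : Fin (2 * n + 1),
              s j' (caseFiveInput σ f ⟨0, by omega⟩ j') ≤ s j (caseFiveInput σ f ⟨0, by omega⟩ j)}
            jstar →
          o jstar (caseFiveInput σ f ⟨0, by omega⟩ jstar) = f ⟨0, by omega⟩ := by
  rintro ⟨s, o, H⟩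
  have : NeZero n := ⟨by omega⟩
  let c : Fin n := ⟨0, by omega⟩
  let d : Fin n := ⟨1, by omega⟩
  have hdc : d ≠ c := by simp [c, d]
  let p (a : Fin n) : Fin (2 * n + 1) := ⟨2 * a + 1, by omega⟩
  obtain ⟨u, hu⟩ := Finite.exists_max (s (p c))
  obtain ⟨v, hv⟩ := Finite.exists_max (s (p d))
  obtain ⟨y, hy⟩ := exists_isLeast_argmax_odd (c := c) (by omega) H 1 (fun _ => v) (a := c) rfl
  obtain ⟨z, hz⟩ := exists_isLeast_argmax_odd (c := c) (by omega) H (Equiv.swap c d) (fun _ => u)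
    (a := d) (Equiv.swap_apply_right c d)
  have hvy : s (p d) v ≤ s (p c) y := by
    simpa only [p, caseFiveInput_odd, Equiv.Perm.one_apply, Function.update_self,
      Function.update_of_ne hdc] using hy.1 (p d)
  have huz : s (p c) u < s (p d) z := by
    by_contra! hle
    have h : p d ≤ p c := by
      refine hz.2 fun k => (hz.1 k).trans ?_
      simpa only [p, caseFiveInput_odd, Equiv.swap_apply_left, Equiv.swap_apply_right,
        Function.update_self, Function.update_of_ne hdc] using hle
    simp [p, c, d] at h
  exact (((hu y).trans_lt huz).trans_le ((hv z).trans hvy)).false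
end

section
/- Let n ≥ 4 be an integer. There do not exist functions s : Fin (2n+1) → Fin n → ℝ (attention scores) and o : Fin (2n+1) → Fin n → Fin n (output rule) with the following property: for every permutation π of Fin n and every f : Fin n → Fin n, letting t : Fin (2n+1) → Fin n be the case-5 input with target key 0, and letting j* be the greatest j ∈ Fin (2n+1) maximizing j ↦ s j (t j), one has o j* (t j*) = f(0). -/
/-- The position attended to under rightmost hard attention: `j` is the greatest maximizer of
the score `a`. -/
def IsRightmostArgmax {m : ℕ} (a : Fin m → ℝ) (j : Fin m) : Prop :=
  IsGreatest {j : Fin m | ∀ j', a j' ≤ a j} j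

theorem exists_isRightmostArgmax {m : ℕ} (a : Fin (m + 1) → ℝ) :
    ∃ j, IsRightmostArgmax a j := by
  obtain ⟨j₀, hj₀⟩ := Finite.exists_max a
  obtain ⟨j, hj⟩ := (Set.toFinite {j | ∀ j', a j' ≤ a j}).exists_maximal ⟨j₀, hj₀⟩
  exact ⟨j, hj.1, fun k hk => not_lt.1 fun hlt => hlt.not_ge (hj.2 hk hlt.le)⟩

/-- If two scores agree away from `c` and neither attends to `c`, they attend to the same
position. -/
theorem IsRightmostArgmax.eq_of_agree_off {m : ℕ} {a b : Fin m → ℝ} {c j k : Fin m}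
    (hab : ∀ i, i ≠ c → a i = b i) (hj : IsRightmostArgmax a j) (hk : IsRightmostArgmax b k)
    (hjc : j ≠ c) (hkc : k ≠ c) : j = k := by
  have h₁ : a k ≤ a j := hj.1 k
  have h₂ : b j ≤ b k := hk.1 j
  have e₁ := hab j hjc
  have e₂ := hab k hkc
  refine le_antisymm (hk.2 fun i => ?_) (hj.2 fun i => ?_)
  · linarith [hk.1 i]
  · linarith [hj.1 i]

/-- The function sending the key `z` to `v` and every other key to `w`. -/
def twoValued {n : ℕ} (z v w : Fin n) : Fin n → Fin n :=
  fun k => if k = z then v else w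

theorem caseFiveInput_odd_s9 {n : ℕ} (σ : Equiv.Perm (Fin n)) (f : Fin n → Fin n) (z p : Fin n)
    (i : Fin (2 * n + 1)) (hi : (i : ℕ) = 2 * p + 1) : caseFiveInput σ f z i = f (σ p) := by
  have hp : (⟨(i : ℕ) / 2, by omega⟩ : Fin n) = p := Fin.ext (by simp only; omega)
  have h₁ : (i : ℕ) < 2 * n := by omega
  have h₂ : ¬ (i : ℕ) % 2 = 0 := by omega
  rw [caseFiveInput, dif_pos h₁, if_neg h₂, hp]

theorem caseFiveInput_twoValued_agree_off {n : ℕ} (σ : Equiv.Perm (Fin n)) (z p v v' w : Fin n)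
    (hp : σ p = z) (i c : Fin (2 * n + 1)) (hc : (c : ℕ) = 2 * p + 1) (hi : i ≠ c) :
    caseFiveInput σ (twoValued z v w) z i = caseFiveInput σ (twoValued z v' w) z i := by
  unfold caseFiveInput
  split_ifs with h₁ h₂
  · rfl
  · have hne : σ ⟨(i : ℕ) / 2, by omega⟩ ≠ z := by
      rw [← hp, σ.injective.ne_iff]
      intro h
      have h' := congrArg Fin.val h
      simp only at h'
      exact hi (Fin.ext (by omega))
    simp [twoValued, hne]
  · rfl

/-- A transformer that evaluates correctly on target key `z` attends to the value of `z` for at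
least one of any two distinct candidate values. -/
theorem attends_value_or {n : ℕ} {s : Fin (2 * n + 1) → Fin n → ℝ}
    {o : Fin (2 * n + 1) → Fin n → Fin n} {z : Fin n}
    (H : ∀ (σ : Equiv.Perm (Fin n)) (f : Fin n → Fin n) (j : Fin (2 * n + 1)),
      IsRightmostArgmax (fun i => s i (caseFiveInput σ f z i)) j →
        o j (caseFiveInput σ f z j) = f z)
    (σ : Equiv.Perm (Fin n)) (p : Fin n) (hp : σ p = z) (c : Fin (2 * n + 1))
    (hc : (c : ℕ) = 2 * p + 1) {v v' : Fin n} (hv : v ≠ v') (w : Fin n) :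
    IsRightmostArgmax (fun i => s i (caseFiveInput σ (twoValued z v w) z i)) c ∨
      IsRightmostArgmax (fun i => s i (caseFiveInput σ (twoValued z v' w) z i)) c := by
  obtain ⟨j, hj⟩ := exists_isRightmostArgmax
    fun i => s i (caseFiveInput σ (twoValued z v w) z i)
  obtain ⟨k, hk⟩ := exists_isRightmostArgmax
    fun i => s i (caseFiveInput σ (twoValued z v' w) z i)
  by_cases hjc : j = c
  · exact Or.inl (hjc ▸ hj)
  by_cases hkc : k = c
  · exact Or.inr (hkc ▸ hk)
  have agree := fun i => caseFiveInput_twoValued_agree_off σ z p v v' w hp i c hc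
  have hjk : j = k := hj.eq_of_agree_off (fun i hi => by simp only [agree i hi]) hk hjc hkc
  subst hjk
  have h₁ := H σ _ j hj
  have h₂ := H σ _ j hk
  rw [agree j hjc, h₂] at h₁
  simp only [twoValued, if_true] at h₁
  exact absurd h₁.symm hv

/-- rightmost hard attention part of Theorem 6: Let `n ≥ 4`.  There are no
attention scores `s : Fin (2n+1) → Fin n → ℝ` and output rule
`o : Fin (2n+1) → Fin n → Fin n` such that for every permutation `σ` of `Fin n` and every
`f : Fin n → Fin n`, with `t` the case-5 input with target key `0`, the greatest
`j* ∈ Fin (2n+1)` maximizing `j ↦ s j (t j)` satisfies `o j* (t j*) = f 0`. -/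
theorem no_one_layer_rightmost_hard_attention_for_case5 (n : ℕ) (hn : 4 ≤ n) :
    ¬ ∃ (s : Fin (2 * n + 1) → Fin n → ℝ) (o : Fin (2 * n + 1) → Fin n → Fin n),
      ∀ (σ : Equiv.Perm (Fin n)) (f : Fin n → Fin n),
        ∀ jstar : Fin (2 * n + 1),
          IsGreatest {j : Fin (2 * n + 1) | ∀ j' : Fin (2 * n + 1),
              s j' (caseFiveInput σ f ⟨0, by omega⟩ j') ≤ s j (caseFiveInput σ f ⟨0, by omega⟩ j)}
            jstar →
          o jstar (caseFiveInput σ f ⟨0, by omega⟩ jstar) = f ⟨0, by omega⟩ := by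
  rintro ⟨s, o, H⟩
  set z : Fin n := ⟨0, by omega⟩
  let q : Fin n := ⟨1, by omega⟩
  have hzq : z ≠ q := by simp [z, q]
  let c : Fin (2 * n + 1) := ⟨1, by omega⟩
  let d : Fin (2 * n + 1) := ⟨3, by omega⟩
  have hc : (c : ℕ) = 2 * z + 1 := rfl
  have hd : (d : ℕ) = 2 * q + 1 := rfl
  have first_wins : ∀ v w, IsRightmostArgmax
      (fun i => s i (caseFiveInput (Equiv.refl _) (twoValued z v w) z i)) c →
      s d w < s c v := by
    intro v w h
    have tc : caseFiveInput (Equiv.refl _) (twoValued z v w) z c = v := by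
      simp [caseFiveInput_odd_s9 _ _ _ z c hc, twoValued]
    have td : caseFiveInput (Equiv.refl _) (twoValued z v w) z d = w := by
      simp [caseFiveInput_odd_s9 _ _ _ q d hd, twoValued, hzq.symm]
    by_contra! hle
    have hdc : d ≤ c := h.2 fun i => (h.1 i).trans (by simpa only [tc, td] using hle)
    simp [c, d] at hdc
  have second_wins : ∀ v w, IsRightmostArgmax
      (fun i => s i (caseFiveInput (Equiv.swap z q) (twoValued z w v) z i)) d →
      s c v ≤ s d w := by
    intro v w h
    have tc : caseFiveInput (Equiv.swap z q) (twoValued z w v) z c = v := by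
      simp [caseFiveInput_odd_s9 _ _ _ z c hc, twoValued, hzq.symm]
    have td : caseFiveInput (Equiv.swap z q) (twoValued z w v) z d = w := by
      simp [caseFiveInput_odd_s9 _ _ _ q d hd, twoValued]
    simpa only [tc, td] using h.1 c
  have column : ∀ w v v', v ≠ v' → s d w < s c v ∨ s d w < s c v' := fun w _ _ hv =>
    (attends_value_or H (Equiv.refl _) z rfl c hc hv w).imp (first_wins _ _) (first_wins _ _)
  have row : ∀ v w w', w ≠ w' → s c v ≤ s d w ∨ s c v ≤ s d w' := fun v _ _ hw =>
    (attends_value_or H (Equiv.swap z q) q (Equiv.swap_apply_right z q) d hd hw v).imp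
      (second_wins _ _) (second_wins _ _)
  have : Nonempty (Fin n) := ⟨z⟩
  obtain ⟨w, hw⟩ := Finite.exists_max (s d)
  obtain ⟨v, hv⟩ : ∃ v, s d w < s c v := (column w z q hzq).elim (⟨_, ·⟩) (⟨_, ·⟩)
  rcases row v z q hzq with h | h <;> exact absurd (h.trans (hw _)) hv.not_ge
end

section
/- For every integer n ≥ 2, there is no function G : Multiset (Fin n) → Fin n such that for every f : Fin n → Fin n and every i* ∈ Fin n, G applied to the multiset {f(0), f(1), …, f(n−1)} + {i*} (i.e., (Finset.univ.val.map f) + {i*}) equals f(i*). -/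
/-- For every integer `n ≥ 2`, there is no function
`G : Multiset (Fin n) → Fin n` such that for every `f : Fin n → Fin n` and every
`i* ∈ Fin n`, `G` applied to the multiset `{f 0, …, f (n−1)} + {i*}` equals `f i*`.
This formalizes the claim that no transformer without position embedding can perform
case-1 function evaluation, since such a transformer computes a permutation-invariant
function of its input tokens. -/
theorem no_multiset_function_for_case1 (n : ℕ) (hn : 2 ≤ n) :
    ¬ ∃ G : Multiset (Fin n) → Fin n,
      ∀ (f : Fin n → Fin n) (istar : Fin n),
        G ((Finset.univ.val.map f) + {istar}) = f istar := by
  rintro ⟨G, hG⟩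
  let a : Fin n := ⟨0, by omega⟩
  let b : Fin n := ⟨1, by omega⟩
  have hperm : Finset.univ.val.map (Equiv.swap a b) = Finset.univ.val.map (id : Fin n → Fin n) := by
    rw [Multiset.map_univ_val_equiv, Multiset.map_id]
  have hab : b = a := by
    rw [← Equiv.swap_apply_left a b, ← hG (Equiv.swap a b) a, hperm, hG id a, id]
  simp [a, b] at hab
end

section
/- For every integer n ≥ 2, there is no function G : Multiset (Fin n) → Fin n such that for every f : Fin n → Fin n and every i* ∈ Fin n, G applied to the multiset {0, 1, …, n−1} + {f(0), f(1), …, f(n−1)} + {i*} (i.e., Finset.univ.val + (Finset.univ.val.map f) + {i*}) equals f(i*). -/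
/-- For every integer `n ≥ 2`, there is no function
`G : Multiset (Fin n) → Fin n` such that for every `f : Fin n → Fin n` and every
`i* ∈ Fin n`, `G` applied to the multiset `{0, …, n−1} + {f 0, …, f (n−1)} + {i*}`
equals `f i*`.  This formalizes the claim that no transformer without position
embedding can perform function evaluation with keys and values in consecutive
positions (cases 4 and 5), since such a transformer computes a permutation-invariant
function of its input tokens. -/
theorem no_multiset_function_for_consecutive_cases (n : ℕ) (hn : 2 ≤ n) :
    ¬ ∃ G : Multiset (Fin n) → Fin n,
      ∀ (f : Fin n → Fin n) (istar : Fin n),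
        G (Finset.univ.val + (Finset.univ.val.map f) + {istar}) = f istar := by
  rintro ⟨G, hG⟩
  let a : Fin n := ⟨0, by omega⟩
  let b : Fin n := ⟨1, by omega⟩
  have hid := hG (Equiv.refl (Fin n)) a
  have hswap := hG (Equiv.swap a b) a
  rw [Multiset.map_univ_val_equiv] at hid hswap
  have hab : a = b := by simpa using hid.symm.trans hswap
  exact absurd (congrArg Fin.val hab) Nat.zero_ne_one
end
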